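/- Splitting off monogenics in each degree (key step in the proof of Lemma 4.3). Assume m ≥ 2k and let ℓ ∈ ℕ. Then P_ℓ⊗C_m = M_ℓ ⊕ (x_1·(P_{ℓ−1}⊗C_m) + ⋯ + x_k·(P_{ℓ−1}⊗C_m)); that is, every C_m-valued polynomial homogeneous of degree ℓ is the sum of a monogenic polynomial of degree ℓ and an element of Σ_{j=1}^k x_j·(P_{ℓ−1}⊗C_m), and M_ℓ ∩ (Σ_{j=1}^k x_j·(P_{ℓ−1}⊗C_m)) = {0}. -/

import Mathlib

open scoped TensorProduct

noncomputable section

/-- Scalar polynomials in the m·k variables x_{li}. -/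
abbrev Pscal (m k : ℕ) := MvPolynomial (Fin m × Fin k) ℂ

/-- The quadratic form Q(z) = -(z₁² + ⋯ + z_m²) on ℂ^m. -/
def Qf (m : ℕ) : QuadraticForm ℂ (Fin m → ℂ) :=
  QuadraticMap.weightedSumSquares ℂ (fun _ : Fin m => (-1 : ℂ))

/-- The complex Clifford algebra C_m. -/
abbrev Cl (m : ℕ) := CliffordAlgebra (Qf m)

/-- The generator e_l of the Clifford algebra. -/
def e (m : ℕ) (l : Fin m) : Cl m := CliffordAlgebra.ι (Qf m) (Pi.single l 1)

/-- C_m-valued polynomials. -/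
abbrev PC (m k : ℕ) := Pscal m k ⊗[ℂ] Cl m

/-- Partial derivative ∂_{x_{li}} acting on C_m-valued polynomials. -/
def pd (m k : ℕ) (l : Fin m) (i : Fin k) : PC m k →ₗ[ℂ] PC m k :=
  LinearMap.rTensor (Cl m) (MvPolynomial.pderiv (l, i)).toLinearMap

/-- The j-th Dirac operator ∂_{x_j} = Σ_l e_l ∂_{x_{lj}}. -/
def dirac (m k : ℕ) (j : Fin k) : PC m k →ₗ[ℂ] PC m k :=
  ∑ l : Fin m,
    (LinearMap.mulLeft ℂ ((1 : Pscal m k) ⊗ₜ[ℂ] e m l)) ∘ₗ pd m k l j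

/-- The space M of monogenic polynomials. -/
def Mono (m k : ℕ) : Submodule ℂ (PC m k) :=
  ⨅ j : Fin k, LinearMap.ker (dirac m k j)

/-- The j-th vector variable x_j = Σ_l e_l x_{lj}. -/
def xv (m k : ℕ) (j : Fin k) : PC m k :=
  ∑ l : Fin m, (MvPolynomial.X (l, j) : Pscal m k) ⊗ₜ[ℂ] e m l

/-- For J = {j₁ < ⋯ < j_r} ⊆ {1,…,k}, the product x_J = x_{j₁} ⋯ x_{j_r}. -/
def xJ (m k : ℕ) (J : Finset (Fin k)) : PC m k :=
  ((J.sort (· ≤ ·)).map (xv m k)).prod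

/-- The invariant r²_ij = Σ_l x_{li} x_{lj}. -/
def rP (m k : ℕ) (i j : Fin k) : Pscal m k :=
  ∑ l : Fin m, MvPolynomial.X (l, i) * MvPolynomial.X (l, j)

/-- Products ∏_{1≤i≤j≤k} r_ij^{2 n_ij} indexed by finitely supported families. -/
def rprod (m k : ℕ) (n : {p : Fin k × Fin k // p.1 ≤ p.2} →₀ ℕ) : Pscal m k :=
  n.prod fun p e => rP m k p.1.1 p.1.2 ^ (2 * e)

/-- The element (∏ r_ij^{2n_ij}) · x_J of P⊗C_m. -/
def basisElem (m k : ℕ) (J : Finset (Fin k))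
    (n : {p : Fin k × Fin k // p.1 ≤ p.2} →₀ ℕ) : PC m k :=
  (rprod m k n ⊗ₜ[ℂ] (1 : Cl m)) * xJ m k J

/-- The operator Δ_ij = Σ_l ∂_{x_{li}} ∂_{x_{lj}} on scalar polynomials. -/
def lap (m k : ℕ) (i j : Fin k) : Pscal m k →ₗ[ℂ] Pscal m k :=
  ∑ l : Fin m,
    (MvPolynomial.pderiv (l, i)).toLinearMap ∘ₗ (MvPolynomial.pderiv (l, j)).toLinearMap

/-- The space H of harmonic scalar polynomials. -/
def Harm (m k : ℕ) : Submodule ℂ (Pscal m k) :=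
  ⨅ p : {p : Fin k × Fin k // p.1 ≤ p.2}, LinearMap.ker (lap m k p.1.1 p.1.2)

/-- The operator Δ_ij acting on C_m-valued polynomials. -/
def lapC (m k : ℕ) (i j : Fin k) : PC m k →ₗ[ℂ] PC m k :=
  ∑ l : Fin m, pd m k l i ∘ₗ pd m k l j

/-- The space of C_m-valued harmonic polynomials. -/
def HarmC (m k : ℕ) : Submodule ℂ (PC m k) :=
  ⨅ p : {p : Fin k × Fin k // p.1 ≤ p.2}, LinearMap.ker (lapC m k p.1.1 p.1.2)

/-- The operator E_ij = Σ_l x_{li} ∂_{x_{lj}} acting on C_m-valued polynomials. -/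
def Eop (m k : ℕ) (i j : Fin k) : PC m k →ₗ[ℂ] PC m k :=
  ∑ l : Fin m,
    (LinearMap.mulLeft ℂ ((MvPolynomial.X (l, i) : Pscal m k) ⊗ₜ[ℂ] (1 : Cl m))) ∘ₗ pd m k l j

/-- The space M^S of simplicial monogenic polynomials. -/
def SimpMono (m k : ℕ) : Submodule ℂ (PC m k) :=
  Mono m k ⊓ ⨅ p : {p : Fin k × Fin k // p.1 < p.2}, LinearMap.ker (Eop m k p.1.1 p.1.2)

/-- Scalar polynomials homogeneous of total degree ℓ. -/
abbrev Pdeg (m k : ℕ) (ℓ : ℕ) : Submodule ℂ (Pscal m k) :=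
  MvPolynomial.homogeneousSubmodule (Fin m × Fin k) ℂ ℓ

/-- Scalar homogeneous polynomials, zero in negative degrees. -/
def PdegZ (m k : ℕ) (n : ℤ) : Submodule ℂ (Pscal m k) :=
  if 0 ≤ n then Pdeg m k n.toNat else ⊥

/-- C_m-valued polynomials homogeneous of total degree ℓ. -/
def PCdeg (m k : ℕ) (ℓ : ℕ) : Submodule ℂ (PC m k) :=
  LinearMap.range (LinearMap.rTensor (Cl m) (Pdeg m k ℓ).subtype)

/-- C_m-valued homogeneous polynomials, zero in negative degrees. -/
def PCdegZ (m k : ℕ) (n : ℤ) : Submodule ℂ (PC m k) :=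
  if 0 ≤ n then PCdeg m k n.toNat else ⊥

/-- Monogenic polynomials homogeneous of given degree, zero in negative degrees. -/
def MdegZ (m k : ℕ) (n : ℤ) : Submodule ℂ (PC m k) :=
  if 0 ≤ n then Mono m k ⊓ PCdeg m k n.toNat else ⊥

/-- C_m-valued polynomials multihomogeneous of degree a_i in the i-th column x_{1i},…,x_{mi}. -/
def PCmdeg (m k : ℕ) (a : Fin k → ℕ) : Submodule ℂ (PC m k) :=
  LinearMap.range (LinearMap.rTensor (Cl m)
    (MvPolynomial.weightedHomogeneousSubmodule ℂ
      (fun p : Fin m × Fin k => Pi.single p.2 1) a).subtype)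

/-- The action of SO(m) on scalar polynomials by x_{li} ↦ Σ_s g_{sl} x_{si}. -/
def soAct (m k : ℕ) (g : Matrix (Fin m) (Fin m) ℝ) : Pscal m k →ₐ[ℂ] Pscal m k :=
  MvPolynomial.aeval fun p : Fin m × Fin k =>
    ∑ s : Fin m, MvPolynomial.C (g s p.1 : ℂ) * MvPolynomial.X (s, p.2)

/-- The Fischer inner product on scalar polynomials. -/
def fischer (m k : ℕ) (f g : Pscal m k) : ℂ :=
  ∑ α ∈ f.support,
    (α.prod fun _ e => (Nat.factorial e : ℂ)) * (starRingEnd ℂ) (f.coeff α) * g.coeff α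


section MonoHelpers

instance cl_finite (m : ℕ) : Module.Finite ℂ (Cl m) := by
  haveI : Invertible (2 : ℂ) := invertibleOfNonzero two_ne_zero
  haveI : Module.Finite ℂ (ExteriorAlgebra ℂ (Fin m → ℂ)) :=
    Module.Finite.of_basis ((Pi.basisFun ℂ (Fin m)).ExteriorAlgebra)
  exact Module.Finite.equiv (CliffordAlgebra.equivExterior (Qf m)).symm

theorem e_sq (m : ℕ) (l : Fin m) : e m l * e m l = -1 := by
  unfold e
  rw [CliffordAlgebra.ι_sq_scalar]
  have h : Qf m (Pi.single l 1) = -1 := by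
    simp [Qf, QuadraticMap.weightedSumSquares_apply, Pi.single_apply]
  rw [h, map_neg, map_one]

theorem e_anti (m : ℕ) (i j : Fin m) (h : i ≠ j) : e m i * e m j = - (e m j * e m i) := by
  unfold e
  apply CliffordAlgebra.ι_mul_ι_comm_of_isOrtho
  rw [QuadraticMap.isOrtho_def]
  simp only [Qf, QuadraticMap.weightedSumSquares_apply, Pi.add_apply, smul_eq_mul,
    ← Finset.sum_add_distrib]
  refine Finset.sum_congr rfl fun x _ => ?_
  by_cases h1 : x = i
  · subst h1; simp [Pi.single_apply, h]
  · simp [Pi.single_apply, h1]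

/-- pull back a core along an injective linear map -/
@[reducible] noncomputable def coreComap {V W : Type*} [AddCommGroup V] [Module ℂ V]
    [AddCommGroup W] [Module ℂ W]
    (c : InnerProductSpace.Core ℂ W) (f : V →ₗ[ℂ] W) (hf : Function.Injective f) :
    InnerProductSpace.Core ℂ V where
  inner a b := c.inner (f a) (f b)
  conj_inner_symm a b := c.conj_inner_symm _ _
  re_inner_nonneg a := c.re_inner_nonneg _
  add_left a b d := by rw [map_add]; exact c.add_left _ _ _
  smul_left a b r := by rw [map_smul]; exact c.smul_left _ _ _
  definite a h := hf (by rw [map_zero]; exact c.definite _ h)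

/-- averaged core -/
@[reducible] noncomputable def coreAvg {V : Type*} [AddCommGroup V] [Module ℂ V]
    (c : InnerProductSpace.Core ℂ V) (f : V →ₗ[ℂ] V) (hf : Function.Injective f) :
    InnerProductSpace.Core ℂ V where
  inner a b := c.inner a b + c.inner (f a) (f b)
  conj_inner_symm a b := by
    rw [map_add, c.conj_inner_symm, c.conj_inner_symm]
  re_inner_nonneg a := by
    rw [map_add]; exact add_nonneg (c.re_inner_nonneg _) (c.re_inner_nonneg _)
  add_left a b d := by rw [map_add, c.add_left, c.add_left]; ring
  smul_left a b r := by rw [map_smul, c.smul_left, c.smul_left]; ring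
  definite a h := by
    have h2 := congrArg RCLike.re h
    rw [map_add, map_zero] at h2
    have h3 := c.re_inner_nonneg a
    have h4 := c.re_inner_nonneg (f a)
    have h5 : RCLike.re (c.inner a a) = 0 := by linarith
    apply c.definite
    have h6 := c.conj_inner_symm a a
    have h7 := RCLike.conj_eq_iff_re.mp h6
    rw [← h7, h5]; simp

theorem neg_neg_inner {V : Type*} [AddCommGroup V] [Module ℂ V]
    (c : InnerProductSpace.Core ℂ V) (a b : V) : c.inner (-a) (-b) = c.inner a b := by
  have h : ∀ x y, c.inner (-x) y = - c.inner x y := fun x y => by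
    rw [← neg_one_smul ℂ, c.smul_left]; simp
  rw [h, ← c.conj_inner_symm, h, map_neg, c.conj_inner_symm, neg_neg]

theorem exists_core_finset (m : ℕ) (s : Finset (Fin m)) :
    ∃ c : InnerProductSpace.Core ℂ (Cl m),
      ∀ l ∈ s, ∀ a b, c.inner (e m l * a) (e m l * b) = c.inner a b := by
  induction s using Finset.induction_on with
  | empty =>
    let n := Module.finrank ℂ (Cl m)
    let φ : Cl m ≃ₗ[ℂ] EuclideanSpace ℂ (Fin n) :=
      LinearEquiv.ofFinrankEq _ _ (by simp [n])
    exact ⟨coreComap (InnerProductSpace.toCore) φ.toLinearMap φ.injective, by simp⟩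
  | insert i s hi ih =>
    obtain ⟨c, hc⟩ := ih
    have hinj : Function.Injective (LinearMap.mulLeft ℂ (e m i)) := by
      intro a b h
      have h1 := congrArg (fun t => e m i * t) h
      simpa [← mul_assoc, e_sq] using h1
    refine ⟨coreAvg c _ hinj, ?_⟩
    intro l hl a b
    change c.inner (e m l * a) (e m l * b) +
      c.inner (e m i * (e m l * a)) (e m i * (e m l * b)) =
      c.inner a b + c.inner (e m i * a) (e m i * b)
    by_cases h : l = i
    · subst h
      simp only [← mul_assoc, e_sq]
      simp only [neg_mul, one_mul, neg_neg_inner]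
      ring
    · have hls : l ∈ s := (Finset.mem_insert.mp hl).resolve_left h
      simp only [← mul_assoc]
      rw [e_anti m i l (Ne.symm h)]
      simp only [neg_mul, neg_neg_inner, mul_assoc]
      rw [hc l hls, hc l hls]

/-- Fischer-type core on finitely supported functions -/
@[reducible] noncomputable def coreFinsupp {V ι : Type*} [AddCommGroup V] [Module ℂ V]
    (c : InnerProductSpace.Core ℂ V) (w : ι → ℝ) (hw : ∀ i, 0 < w i) :
    InnerProductSpace.Core ℂ (ι →₀ V) where
  inner f g := f.sum fun i a => (w i : ℂ) * c.inner a (g i)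
  conj_inner_symm f g := by
    classical
    have hz : ∀ y, c.inner 0 y = 0 := fun y => by
      have := c.smul_left 0 y 0; simpa using this
    have hz' : ∀ y, c.inner y 0 = 0 := fun y => by
      rw [← c.conj_inner_symm, hz, map_zero]
    rw [Finsupp.sum_of_support_subset g (Finset.subset_union_right (s₁ := f.support)) _
        (by simp [hz]),
      Finsupp.sum_of_support_subset f (Finset.subset_union_left (s₂ := g.support)) _
        (by simp [hz]), map_sum]
    refine Finset.sum_congr rfl fun i _ => ?_
    rw [map_mul, c.conj_inner_symm]; simp
  re_inner_nonneg f := by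
    rw [Finsupp.sum, map_sum]
    refine Finset.sum_nonneg fun i _ => ?_
    have := mul_nonneg (hw i).le (c.re_inner_nonneg (f i))
    simpa using this
  add_left f g h := by
    classical
    have hz : ∀ y, c.inner 0 y = 0 := fun y => by
      have := c.smul_left 0 y 0; simpa using this
    refine Finsupp.sum_add_index' (by simp [hz]) ?_
    intro i a b
    rw [c.add_left, mul_add]
  smul_left f g r := by
    have hz : ∀ y, c.inner 0 y = 0 := fun y => by
      have := c.smul_left 0 y 0; simpa using this
    rw [Finsupp.sum_smul_index' (by simp [hz]), Finsupp.sum, Finsupp.sum, Finset.mul_sum]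
    refine Finset.sum_congr rfl fun i _ => ?_
    rw [c.smul_left]; ring
  definite f h := by
    have h2 := congrArg RCLike.re h
    rw [Finsupp.sum, map_sum, map_zero] at h2
    have hnn : ∀ i, 0 ≤ RCLike.re ((w i : ℂ) * c.inner (f i) (f i)) := fun i => by
      have := mul_nonneg (hw i).le (c.re_inner_nonneg (f i))
      simpa using this
    rw [Finset.sum_eq_zero_iff_of_nonneg (fun i _ => hnn i)] at h2
    ext i
    by_contra hne
    have h3 := h2 i (by simpa using hne)
    have h5 : RCLike.re (c.inner (f i) (f i)) = 0 := by
      have : w i * RCLike.re (c.inner (f i) (f i)) = 0 := by simpa using h3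
      exact (mul_eq_zero.mp this).resolve_left (hw i).ne'
    apply hne
    apply c.definite
    have h7 := RCLike.conj_eq_iff_re.mp (c.conj_inner_symm (f i) (f i))
    rw [← h7, h5]; simp

/-- coefficients -/
noncomputable def coef (m k : ℕ) : PC m k ≃ₗ[ℂ] ((Fin m × Fin k →₀ ℕ) →₀ Cl m) :=
  TensorProduct.equivFinsuppOfBasisLeft (MvPolynomial.basisMonomials (Fin m × Fin k) ℂ)

theorem coef_tmul (m k : ℕ) (p : Pscal m k) (a : Cl m) (α : Fin m × Fin k →₀ ℕ) :
    coef m k (p ⊗ₜ a) α = p.coeff α • a := by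
  rw [coef, TensorProduct.equivFinsuppOfBasisLeft_apply_tmul_apply]
  rfl

theorem coef_monomial (m k : ℕ) (β : Fin m × Fin k →₀ ℕ) (r : ℂ) (a : Cl m) :
    coef m k (MvPolynomial.monomial β r ⊗ₜ a) = Finsupp.single β (r • a) := by
  classical
  ext α
  rw [coef_tmul, MvPolynomial.coeff_monomial, Finsupp.single_apply]
  split_ifs <;> simp

theorem coef_dirac (m k : ℕ) (j : Fin k) (g : PC m k) (α : Fin m × Fin k →₀ ℕ) :
    coef m k (dirac m k j g) α =
      ∑ l, ((α (l, j) : ℂ) + 1) • (e m l * coef m k g (α + Finsupp.single (l, j) 1)) := by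
  induction g using TensorProduct.induction_on with
  | zero => simp
  | add x y hx hy => simp [hx, hy, Finset.sum_add_distrib, mul_add]
  | tmul p a =>
    simp only [dirac, LinearMap.sum_apply, LinearMap.comp_apply, pd, LinearMap.rTensor_tmul,
      LinearMap.mulLeft_apply, Algebra.TensorProduct.tmul_mul_tmul, one_mul, map_sum,
      Finsupp.finsetSum_apply, coef_tmul]
    refine Finset.sum_congr rfl fun l _ => ?_
    erw [MvPolynomial.coeff_pderiv]
    rw [mul_smul_comm, smul_smul, mul_comm]

/-- factorial weight -/
noncomputable def wt {σ : Type*} (α : σ →₀ ℕ) : ℝ := α.prod fun _ n => (Nat.factorial n : ℝ)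

theorem wt_pos {σ : Type*} (α : σ →₀ ℕ) : 0 < wt α :=
  Finset.prod_pos fun i _ => by positivity

theorem wt_succ {σ : Type*} [Fintype σ] (α : σ →₀ ℕ) (i : σ) :
    wt (α + Finsupp.single i 1) = wt α * (α i + 1) := by
  classical
  unfold wt
  rw [Finsupp.prod_fintype _ _ (by simp), Finsupp.prod_fintype _ _ (by simp),
    ← Finset.mul_prod_erase _ _ (Finset.mem_univ i),
    ← Finset.mul_prod_erase Finset.univ (fun t => ((α t).factorial : ℝ)) (Finset.mem_univ i)]
  have : ∀ t ∈ Finset.univ.erase i, (((α + Finsupp.single i 1 : σ →₀ ℕ) t).factorial : ℝ)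
      = ((α t).factorial : ℝ) := by
    intro t ht
    have : i ≠ t := (Finset.ne_of_mem_erase ht).symm
    simp [Finsupp.single_apply, this]
  rw [Finset.prod_congr rfl this]
  simp [Nat.factorial_succ]
  ring

theorem exists_core (m k : ℕ) : ∃ c : InnerProductSpace.Core ℂ (PC m k),
    ∀ j f g, c.inner (xv m k j * f) g = - c.inner f (dirac m k j g) := by
  obtain ⟨c, hc⟩ := exists_core_finset m Finset.univ
  let C : InnerProductSpace.Core ℂ (PC m k) :=
    coreComap (coreFinsupp c wt wt_pos) (coef m k).toLinearMap (coef m k).injective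
  refine ⟨C, fun j f g => ?_⟩
  have hz : ∀ y, c.inner 0 y = 0 := fun y => by
    have := c.smul_left 0 y 0; simpa using this
  have hCz : ∀ y, C.inner 0 y = 0 := fun y => by
    have := C.smul_left 0 y 0; simpa using this
  have hadd : ∀ x y z, c.inner x (y + z) = c.inner x y + c.inner x z := fun x y z => by
    rw [← c.conj_inner_symm, c.add_left, map_add, c.conj_inner_symm, c.conj_inner_symm]
  have hsm : ∀ (r : ℂ) x y, c.inner x (r • y) = r * c.inner x y := fun r x y => by
    rw [← c.conj_inner_symm, c.smul_left, map_mul, c.conj_inner_symm]; simp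
  have hsum : ∀ (x : Cl m) (y : Fin m → Cl m), c.inner x (∑ l, y l) = ∑ l, c.inner x (y l) :=
    fun x y => map_sum (AddMonoidHom.mk' (fun y => c.inner x y) (hadd x)) y _
  have hCsum : ∀ (y : PC m k) (x : Fin m → PC m k), C.inner (∑ l, x l) y = ∑ l, C.inner (x l) y :=
    fun y x => map_sum (AddMonoidHom.mk' (fun x => C.inner x y) (fun a b => C.add_left a b y)) x _
  have hanti : ∀ l a b, c.inner (e m l * a) b = - c.inner a (e m l * b) := fun l a b => by
    have h1 := hc l (Finset.mem_univ _) a (e m l * b)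
    have h2 : e m l * (e m l * b) = (-1 : ℂ) • b := by
      rw [← mul_assoc, e_sq]; simp
    rw [← h1, h2, hsm]; ring
  have hmon : ∀ β r a y, C.inner (MvPolynomial.monomial β r ⊗ₜ a) y =
      wt β * c.inner (r • a) (coef m k y β) := fun β r a y => by
    change ((coef m k) (MvPolynomial.monomial β r ⊗ₜ a)).sum _ = _
    rw [coef_monomial, Finsupp.sum_single_index (by simp [hz])]
    rfl
  induction f using TensorProduct.induction_on with
  | zero => rw [mul_zero, hCz, hCz, neg_zero]
  | add x y hx hy => rw [mul_add, C.add_left, C.add_left, hx, hy, neg_add]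
  | tmul p a =>
    induction p using MvPolynomial.induction_on' with
    | add p q hp hq =>
      rw [TensorProduct.add_tmul, mul_add, C.add_left, C.add_left, hp, hq, neg_add]
    | monomial β r =>
      rw [hmon, coef_dirac, xv, Finset.sum_mul, hCsum, hsum, Finset.mul_sum,
        ← Finset.sum_neg_distrib]
      refine Finset.sum_congr rfl fun l _ => ?_
      rw [Algebra.TensorProduct.tmul_mul_tmul, MvPolynomial.X, MvPolynomial.monomial_mul, one_mul,
        add_comm, hmon, wt_succ, ← mul_smul_comm, hanti, hsm]
      push_cast
      ring

theorem pderiv_homog {σ : Type*} (n : ℕ) (i : σ) (p : MvPolynomial σ ℂ)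
    (hp : p.IsHomogeneous (n + 1)) : (MvPolynomial.pderiv i p).IsHomogeneous n := by
  intro d hd
  rw [MvPolynomial.coeff_pderiv] at hd
  have := hp (left_ne_zero_of_mul hd)
  rw [map_add, Finsupp.weight_single] at this
  simpa using this

theorem pderiv_homog_zero {σ : Type*} (i : σ) (p : MvPolynomial σ ℂ)
    (hp : p.IsHomogeneous 0) : MvPolynomial.pderiv i p = 0 := by
  ext d
  by_contra hd
  rw [MvPolynomial.coeff_pderiv] at hd
  have := hp (left_ne_zero_of_mul hd)
  rw [map_add, Finsupp.weight_single] at this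
  simp at this

theorem PCdeg_induct (m k n : ℕ) (S : Submodule ℂ (PC m k))
    (h : ∀ p : Pscal m k, p.IsHomogeneous n → ∀ a : Cl m, p ⊗ₜ[ℂ] a ∈ S) : PCdeg m k n ≤ S := by
  rintro _ ⟨f, rfl⟩
  induction f using TensorProduct.induction_on with
  | zero => simp
  | add x y hx hy => rw [map_add]; exact S.add_mem hx hy
  | tmul p a => exact h p.1 p.2 a

theorem tmul_mem_PCdeg (m k n : ℕ) (p : Pscal m k) (hp : p.IsHomogeneous n) (a : Cl m) :
    p ⊗ₜ[ℂ] a ∈ PCdeg m k n :=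
  ⟨(⟨p, hp⟩ : Pdeg m k n) ⊗ₜ a, rfl⟩

theorem dirac_tmul (m k : ℕ) (j : Fin k) (p : Pscal m k) (a : Cl m) :
    dirac m k j (p ⊗ₜ a) = ∑ l, (MvPolynomial.pderiv (l, j) p) ⊗ₜ (e m l * a) := by
  simp only [dirac, LinearMap.sum_apply, LinearMap.comp_apply, pd, LinearMap.rTensor_tmul,
      LinearMap.mulLeft_apply, Algebra.TensorProduct.tmul_mul_tmul, one_mul]
  rfl

theorem dirac_mem (m k n : ℕ) (j : Fin k) (f : PC m k) (hf : f ∈ PCdeg m k (n + 1)) :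
    dirac m k j f ∈ PCdeg m k n := by
  refine PCdeg_induct m k (n + 1) ((PCdeg m k n).comap (dirac m k j)) ?_ hf
  intro p hp a
  rw [Submodule.mem_comap, dirac_tmul]
  exact Submodule.sum_mem _ fun l _ => tmul_mem_PCdeg _ _ _ _ (pderiv_homog _ _ _ hp) _

theorem dirac_zero (m k : ℕ) (j : Fin k) (f : PC m k) (hf : f ∈ PCdeg m k 0) :
    dirac m k j f = 0 := by
  refine PCdeg_induct m k 0 (LinearMap.ker (dirac m k j)) ?_ hf
  intro p hp a
  rw [LinearMap.mem_ker, dirac_tmul]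
  exact Finset.sum_eq_zero fun l _ => by rw [pderiv_homog_zero _ _ hp, TensorProduct.zero_tmul]

theorem xv_mem (m k n : ℕ) (j : Fin k) (f : PC m k) (hf : f ∈ PCdeg m k n) :
    xv m k j * f ∈ PCdeg m k (n + 1) := by
  refine PCdeg_induct m k n ((PCdeg m k (n + 1)).comap (LinearMap.mulLeft ℂ (xv m k j))) ?_ hf
  intro p hp a
  rw [Submodule.mem_comap, LinearMap.mulLeft_apply, xv, Finset.sum_mul]
  refine Submodule.sum_mem _ fun l _ => ?_
  rw [Algebra.TensorProduct.tmul_mul_tmul]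
  refine tmul_mem_PCdeg _ _ _ _ ?_ _
  rw [add_comm]
  exact (MvPolynomial.isHomogeneous_X _ _).mul hp

theorem PCdeg_finite (m k n : ℕ) : Module.Finite ℂ (PCdeg m k n) := by
  haveI : Module.Finite ℂ (Pdeg m k n) :=
    Module.Finite.iff_fg.mpr (MvPolynomial.homogeneousSubmodule_fg _ _ _)
  unfold PCdeg
  infer_instance

theorem split_core {V : Type*} [AddCommGroup V] [Module ℂ V] (c : InnerProductSpace.Core ℂ V)
    (U : Submodule ℂ V) [Module.Finite ℂ U] (f : V) :
    ∃ u ∈ U, ∀ w ∈ U, c.inner w (f - u) = 0 := by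
  letI : NormedAddCommGroup V := c.toNormedAddCommGroup
  letI : InnerProductSpace ℂ V := InnerProductSpace.ofCore c.toCore
  exact ⟨U.starProjection f, U.starProjection_apply_mem f, fun w hw =>
    (Submodule.mem_orthogonal U _).mp (U.sub_starProjection_mem_orthogonal f) w hw⟩

end MonoHelpers

end

/-- Splitting off monogenics in each degree (key step in the proof of Lemma 4.3):
P_ℓ⊗C_m = M_ℓ ⊕ (x_1·(P_{ℓ−1}⊗C_m) + ⋯ + x_k·(P_{ℓ−1}⊗C_m)). -/
theorem monogenic_splitting (m k : ℕ) (hm : 1 ≤ m) (hk : 1 ≤ k)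
    (hrange : 2 * k ≤ m) (ℓ : ℕ) :
    (Mono m k ⊓ PCdeg m k ℓ) ⊔
        (⨆ j : Fin k, (PCdegZ m k ((ℓ : ℤ) - 1)).map (LinearMap.mulLeft ℂ (xv m k j))) =
      PCdeg m k ℓ ∧
    (Mono m k ⊓ PCdeg m k ℓ) ⊓
        (⨆ j : Fin k, (PCdegZ m k ((ℓ : ℤ) - 1)).map (LinearMap.mulLeft ℂ (xv m k j))) = ⊥ := by
  obtain ⟨c, hc⟩ := exists_core m k
  have hz : ∀ y, c.inner 0 y = 0 := fun y => by
    have := c.smul_left 0 y 0; simpa using this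
  set U := ⨆ j : Fin k, (PCdegZ m k ((ℓ : ℤ) - 1)).map (LinearMap.mulLeft ℂ (xv m k j)) with hU
  have hUle : U ≤ PCdeg m k ℓ := by
    refine iSup_le fun j => ?_
    rintro _ ⟨g, hg, rfl⟩
    rcases ℓ with _ | n
    · simp [PCdegZ] at hg
      simp [hg]
    · simp [PCdegZ] at hg
      exact xv_mem m k n j g hg
  have hfin : Module.Finite ℂ U := by
    haveI := PCdeg_finite m k ℓ
    exact Submodule.finiteDimensional_of_le hUle
  constructor
  · apply le_antisymm (sup_le inf_le_right hUle)
    intro f hf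
    obtain ⟨u, hu, horth⟩ := split_core c U f
    have hv : f - u ∈ PCdeg m k ℓ := Submodule.sub_mem _ hf (hUle hu)
    refine Submodule.mem_sup.mpr ⟨f - u, ⟨?_, hv⟩, u, hu, by abel⟩
    refine (Submodule.mem_iInf _).mpr fun j => ?_
    rw [LinearMap.mem_ker]
    rcases ℓ with _ | n
    · exact dirac_zero m k j _ hv
    · apply c.definite
      have h1 : xv m k j * dirac m k j (f - u) ∈ U := by
        refine Submodule.mem_iSup_of_mem j ⟨dirac m k j (f - u), ?_, rfl⟩
        simp only [PCdegZ]
        simpa using dirac_mem m k n j _ hv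
      have h2 := horth _ h1
      rw [hc] at h2
      exact neg_eq_zero.mp h2
  · rw [eq_bot_iff]
    rintro f ⟨⟨hf, -⟩, hfU⟩
    have hfj : ∀ j, dirac m k j f = 0 := fun j => (Submodule.mem_iInf _).mp hf j
    have key : ∀ w ∈ U, c.inner w f = 0 := by
      intro w hw
      induction hw using Submodule.iSup_induction' with
      | mem j x hx =>
        obtain ⟨g, -, rfl⟩ := hx
        rw [LinearMap.mulLeft_apply, hc, hfj, ← c.conj_inner_symm, hz, map_zero, neg_zero]
      | zero => exact hz _
      | add x y _ _ hx hy => rw [c.add_left, hx, hy, add_zero]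
    exact (Submodule.mem_bot ℂ).mpr (c.definite f (key f hfU))
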